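/- Upper bound for packing entropy of generic points: Let (X,G) be a G-action topological dynamical system with G a countable infinite discrete amenable group, let μ be a G-invariant Borel probability measure on X, and let {F_n} be a Følner sequence in G satisfying the growth condition. Then h^P_top(G_μ,{F_n}) ≤ h_μ(X,G). -/

import Mathlib

open Filter Set MeasureTheory ENNReal Topology
open scoped Pointwise symmDiff NNReal

namespace AmenablePacking

variable {G X Y : Type*}

/-- The open dynamical (Bowen) ball of center `x` and radius `ε` over the finite set `F`. -/
def dynBall [PseudoMetricSpace X] (act : G → X → X) (F : Finset G) (x : X) (ε : ℝ) : Set X :=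
  {y | ∀ g ∈ F, dist (act g x) (act g y) < ε}

/-- The closed dynamical (Bowen) ball of center `x` and radius `ε` over the finite set `F`. -/
def dynClosedBall [PseudoMetricSpace X] (act : G → X → X) (F : Finset G) (x : X) (ε : ℝ) :
    Set X :=
  {y | ∀ g ∈ F, dist (act g x) (act g y) ≤ ε}

/-- The packing pre-measure `P(Z, N, ε, s, {F_n})`: the supremum of `∑ᵢ exp (- s |F_{n_i}|)` over
all finite or countable pairwise disjoint families of closed Bowen balls with centers in `Z`
and indices `n_i ≥ N`. -/
noncomputable def packP [PseudoMetricSpace X] (act : G → X → X) (Fs : ℕ → Finset G) (Z : Set X)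
    (N : ℕ) (ε s : ℝ) : ℝ≥0∞ :=
  ⨆ (t : Set ℕ) (c : ℕ → X × ℕ) (_ : ∀ i ∈ t, (c i).1 ∈ Z ∧ N ≤ (c i).2)
    (_ : ∀ i ∈ t, ∀ j ∈ t, i ≠ j →
      Disjoint (dynClosedBall act (Fs (c i).2) (c i).1 ε)
        (dynClosedBall act (Fs (c j).2) (c j).1 ε)),
    ∑' i : t, ENNReal.ofReal (Real.exp (-s * ((Fs (c (i : ℕ)).2).card : ℝ)))

/-- `P(Z, ε, s, {F_n}) = lim_{N → ∞} P(Z, N, ε, s, {F_n})`; the quantity is non-increasing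
in `N`, so the limit equals the infimum. -/
noncomputable def packPLim [PseudoMetricSpace X] (act : G → X → X) (Fs : ℕ → Finset G)
    (Z : Set X) (ε s : ℝ) : ℝ≥0∞ :=
  ⨅ N : ℕ, packP act Fs Z N ε s

/-- `𝒫(Z, ε, s, {F_n})`: the countably subadditive envelope of `P(·, ε, s, {F_n})`. -/
noncomputable def packOuter [PseudoMetricSpace X] (act : G → X → X) (Fs : ℕ → Finset G)
    (Z : Set X) (ε s : ℝ) : ℝ≥0∞ :=
  ⨅ (Zs : ℕ → Set X) (_ : Z ⊆ ⋃ i, Zs i), ∑' i, packPLim act Fs (Zs i) ε s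

/-- `h^P_top(Z, ε, {F_n})`: the critical value of `s ≥ 0` at which `𝒫(Z, ε, s, {F_n})` jumps
from `+∞` to `0`. -/
noncomputable def packEntEps [PseudoMetricSpace X] (act : G → X → X) (Fs : ℕ → Finset G)
    (Z : Set X) (ε : ℝ) : ℝ≥0∞ :=
  ⨅ (s : ℝ≥0) (_ : packOuter act Fs Z ε (s : ℝ) = 0), (s : ℝ≥0∞)

/-- The amenable packing topological entropy
`h^P_top(Z, {F_n}) = lim_{ε → 0} h^P_top(Z, ε, {F_n})`. -/
noncomputable def packEnt [PseudoMetricSpace X] (act : G → X → X) (Fs : ℕ → Finset G)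
    (Z : Set X) : ℝ≥0∞ :=
  ⨆ (ε : ℝ) (_ : 0 < ε), packEntEps act Fs Z ε

/-- The Bowen pre-measure `ℳ(Z, N, ε, s, {F_n})`: the infimum of `∑ᵢ exp (- s |F_{n_i}|)` over
all finite or countable families of open Bowen balls with indices `n_i ≥ N` covering `Z`. -/
noncomputable def bowenM [PseudoMetricSpace X] (act : G → X → X) (Fs : ℕ → Finset G) (Z : Set X)
    (N : ℕ) (ε s : ℝ) : ℝ≥0∞ :=
  ⨅ (t : Set ℕ) (c : ℕ → X × ℕ) (_ : ∀ i ∈ t, N ≤ (c i).2)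
    (_ : Z ⊆ ⋃ i ∈ t, dynBall act (Fs (c i).2) (c i).1 ε),
    ∑' i : t, ENNReal.ofReal (Real.exp (-s * ((Fs (c (i : ℕ)).2).card : ℝ)))

/-- `ℳ(Z, s, {F_n}) = lim_{ε → 0} lim_{N → ∞} ℳ(Z, N, ε, s, {F_n})`. -/
noncomputable def bowenMLim [PseudoMetricSpace X] (act : G → X → X) (Fs : ℕ → Finset G)
    (Z : Set X) (s : ℝ) : ℝ≥0∞ :=
  ⨆ (ε : ℝ) (_ : 0 < ε), ⨆ N : ℕ, bowenM act Fs Z N ε s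

/-- The amenable Bowen topological entropy `h^B_top(Z, {F_n})`: the critical value of `s ≥ 0`
at which `ℳ(Z, s, {F_n})` jumps from `+∞` to `0`. -/
noncomputable def bowenEnt [PseudoMetricSpace X] (act : G → X → X) (Fs : ℕ → Finset G)
    (Z : Set X) : ℝ≥0∞ :=
  ⨅ (s : ℝ≥0) (_ : bowenMLim act Fs Z (s : ℝ) = 0), (s : ℝ≥0∞)

/-- `E` is an `(F, ε)`-separated set: distinct points are at `d_F`-distance `> ε`. -/
def IsDynSeparated [PseudoMetricSpace X] (act : G → X → X) (F : Finset G) (ε : ℝ)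
    (E : Set X) : Prop :=
  ∀ x ∈ E, ∀ y ∈ E, x ≠ y → ∃ g ∈ F, ε < dist (act g x) (act g y)

/-- `s_F(Z, ε)`: the maximal cardinality of an `(F, ε)`-separated subset of `Z`. -/
noncomputable def sepNum [PseudoMetricSpace X] (act : G → X → X) (F : Finset G) (Z : Set X)
    (ε : ℝ) : ℕ :=
  sSup {k : ℕ | ∃ E : Finset X, ↑E ⊆ Z ∧ IsDynSeparated act F ε ↑E ∧ E.card = k}

/-- The upper capacity entropy of `Z` at scale `ε`:
`limsup_n (1/|F_n|) log s_{F_n}(Z, ε)`. -/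
noncomputable def ucEntEps [PseudoMetricSpace X] (act : G → X → X) (Fs : ℕ → Finset G)
    (Z : Set X) (ε : ℝ) : ℝ≥0∞ :=
  limsup (fun n => ENNReal.ofReal (Real.log ((sepNum act (Fs n) Z ε : ℝ)) / ((Fs n).card : ℝ)))
    atTop

/-- The upper capacity topological entropy `h^{UC}_top(Z, {F_n})`. -/
noncomputable def ucEnt [PseudoMetricSpace X] (act : G → X → X) (Fs : ℕ → Finset G)
    (Z : Set X) : ℝ≥0∞ :=
  ⨆ (ε : ℝ) (_ : 0 < ε), ucEntEps act Fs Z ε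

/-- The upper local entropy `h̄^loc_μ(Z, {F_n}) =
`∫_Z lim_{ε→0} limsup_n -(1/|F_n|) log μ(B_{F_n}(x, ε)) dμ`. -/
noncomputable def upperLocalEnt [PseudoMetricSpace X] [MeasurableSpace X] (act : G → X → X)
    (Fs : ℕ → Finset G) (μ : Measure X) (Z : Set X) : ℝ≥0∞ :=
  ∫⁻ x in Z, ⨆ (ε : ℝ) (_ : 0 < ε),
    limsup (fun n =>
      ENNReal.ofReal (-Real.log ((μ (dynBall act (Fs n) x ε)).toReal) / ((Fs n).card : ℝ)))
      atTop ∂μ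

/-- A Følner sequence: a sequence of nonempty finite subsets of `G` which is asymptotically
invariant, i.e. `|g F_n ∆ F_n| / |F_n| → 0` for every `g ∈ G`. -/
def Folner [Group G] [DecidableEq G] (Fs : ℕ → Finset G) : Prop :=
  (∀ n, (Fs n).Nonempty) ∧
    ∀ g : G,
      Tendsto (fun n => ((((Fs n).image fun h => g * h) ∆ Fs n).card : ℝ) / ((Fs n).card : ℝ))
        atTop (nhds 0)

/-- A tempered sequence: `|⋃_{k < n} F_k⁻¹ F_n| ≤ C |F_n|` for a constant `C > 0`. -/
def Tempered [Group G] [DecidableEq G] (Fs : ℕ → Finset G) : Prop :=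
  ∃ C : ℝ, 0 < C ∧
    ∀ n : ℕ, ((((Finset.range n).biUnion fun k => (Fs k)⁻¹ * Fs n).card : ℝ))
      ≤ C * ((Fs n).card : ℝ)

/-- The growth condition `lim_n |F_n| / log n = +∞`. -/
def GrowthCond (Fs : ℕ → Finset G) [Group G] : Prop :=
  Tendsto (fun n => ((Fs n).card : ℝ) / Real.log (n : ℝ)) atTop atTop

/-- The static (Shannon) entropy of the finite measurable partition of `X` induced by a map
into a finite set. -/
noncomputable def partEnt [MeasurableSpace X] (μ : Measure X) {ι : Type*} [Fintype ι]
    (P : X → ι) : ℝ :=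
  ∑ i : ι, Real.negMulLog ((μ (P ⁻¹' {i})).toReal)

/-- The measure-theoretic (Kolmogorov–Sinai) entropy `h_μ(X, G)` of the action w.r.t. the
invariant measure `μ`, computed along the Følner sequence `{F_n}`: the supremum over finite
measurable partitions `P` of `lim_n (1/|F_n|) H_μ(⋁_{g ∈ F_n} (act g)⁻¹ P)`. -/
noncomputable def measEnt [MeasurableSpace X] [DecidableEq G] (act : G → X → X)
    (Fs : ℕ → Finset G) (μ : Measure X) : ℝ≥0∞ :=
  ⨆ (k : ℕ) (P : X → Fin k) (_ : Measurable P),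
    limsup (fun n => ENNReal.ofReal
      ((partEnt μ fun x (g : (Fs n : Finset G)) => P (act (g : G) x)) / ((Fs n).card : ℝ)))
      atTop

/-- The set of generic points of `μ` w.r.t. `{F_n}`. -/
def genericPoints [TopologicalSpace X] [MeasurableSpace X] (act : G → X → X)
    (Fs : ℕ → Finset G) (μ : Measure X) : Set X :=
  {x | ∀ f : C(X, ℝ),
    Tendsto (fun n => (∑ g ∈ Fs n, f (act g x)) / ((Fs n).card : ℝ)) atTop
      (nhds (∫ y, f y ∂μ))}

/-- `μ` is invariant under the action. -/
def InvariantMeasure [MeasurableSpace X] (act : G → X → X) (μ : Measure X) : Prop :=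
  ∀ (g : G) (s : Set X), MeasurableSet s → μ (act g ⁻¹' s) = μ s

/-- The action is ergodic w.r.t. `μ`: every invariant measurable set is null or conull. -/
def ErgodicAction [MeasurableSpace X] (act : G → X → X) (μ : Measure X) : Prop :=
  ∀ s : Set X, MeasurableSet s → (∀ g : G, act g ⁻¹' s = s) → μ s = 0 ∨ μ s = 1


section Counting

variable {ι α : Type*}

open scoped Classical in
/-- The number of points of `E` whose name agrees with that of `x` on the coordinates in `S`. -/
noncomputable def agreeCount (E : Finset X) (w : X → ι → α) (S : Finset ι) (x : X) : ℕ :=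
  (E.filter fun y => ∀ i ∈ S, w y i = w x i).card

/-- `|E|` times the Shannon entropy of the names on the coordinates in `S`, with respect to the
uniform measure on `E`. -/
noncomputable def nameEnt (E : Finset X) (w : X → ι → α) (S : Finset ι) : ℝ :=
  ∑ x ∈ E, (Real.log E.card - Real.log (agreeCount E w S x))

lemma agreeCount_pos {E : Finset X} (w : X → ι → α) (S : Finset ι) {x : X} (hx : x ∈ E) :
    0 < agreeCount E w S x := by
  classical
  exact Finset.card_pos.2 ⟨x, by simp [hx]⟩

lemma agreeCount_congr (E : Finset X) (w : X → ι → α) (S : Finset ι) {x y : X}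
    (h : ∀ i ∈ S, w x i = w y i) : agreeCount E w S x = agreeCount E w S y := by
  classical
  unfold agreeCount
  congr 1
  ext z
  simp only [Finset.mem_filter]
  refine and_congr_right fun _ => forall₂_congr fun i hi => ?_
  rw [h i hi]

lemma nameEnt_mono (E : Finset X) (w : X → ι → α) {S T : Finset ι} (h : S ⊆ T) :
    nameEnt E w S ≤ nameEnt E w T := by
  classical
  refine Finset.sum_le_sum fun x hx => ?_
  have h1 := agreeCount_pos w T hx
  have h2 : agreeCount E w T x ≤ agreeCount E w S x := by
    refine Finset.card_le_card fun y => ?_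
    simp only [Finset.mem_filter]
    exact fun hy => ⟨hy.1, fun i hi => hy.2 i (h hi)⟩
  have : Real.log (agreeCount E w T x) ≤ Real.log (agreeCount E w S x) :=
    Real.log_le_log (by exact_mod_cast h1) (by exact_mod_cast h2)
  linarith

lemma nameEnt_empty (E : Finset X) (w : X → ι → α) : nameEnt E w ∅ = 0 := by
  simp [nameEnt, agreeCount]

lemma sum_agreeCount_ratio_le [DecidableEq ι] (E : Finset X) (w : X → ι → α) {A B C : Finset ι}
    (hA : C ⊆ A) (hB : C ⊆ B) :
    ∑ x ∈ E, (agreeCount E w A x * agreeCount E w B x : ℝ) /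
      (agreeCount E w (A ∪ B) x * agreeCount E w C x) ≤ E.card := by
  classical
  let r (S : Finset ι) (x y : X) : Prop := ∀ i ∈ S, w y i = w x i
  have key : ∀ y ∈ E, ∀ z ∈ E, ∑ x ∈ E with r A x y ∧ r B x z,
      (1 : ℝ) / (agreeCount E w (A ∪ B) x * agreeCount E w C x) ≤
        if r C y z then (1 : ℝ) / agreeCount E w C y else 0 := by
    intro y hy z hz
    rcases (E.filter fun x => r A x y ∧ r B x z).eq_empty_or_nonempty with h | ⟨x₀, h₀⟩
    · rw [h]
      simp only [Finset.sum_empty]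
      positivity
    simp only [Finset.mem_filter] at h₀
    obtain ⟨hx₀, hay, hbz⟩ := h₀
    have hyz : r C y z := fun i hi => (hbz i (hB hi)).trans (hay i (hA hi)).symm
    rw [if_pos hyz]
    have hpos : (0 : ℝ) < agreeCount E w (A ∪ B) x₀ := by
      exact_mod_cast agreeCount_pos w _ hx₀
    have hposy : (0 : ℝ) < agreeCount E w C y := by
      exact_mod_cast agreeCount_pos w _ hy
    have heq : ∀ x ∈ E.filter (fun x => r A x y ∧ r B x z),
        (1 : ℝ) / (agreeCount E w (A ∪ B) x * agreeCount E w C x) =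
          1 / (agreeCount E w (A ∪ B) x₀ * agreeCount E w C y) := by
      intro x hx
      simp only [Finset.mem_filter] at hx
      obtain ⟨_, hxa, hxb⟩ := hx
      rw [agreeCount_congr E w (A ∪ B) (x := x) (y := x₀),
        agreeCount_congr E w C (x := x) (y := y)]
      · exact fun i hi => (hxa i (hA hi)).symm
      · intro i hi
        rcases Finset.mem_union.1 hi with hi | hi
        · exact (hxa i hi).symm.trans (hay i hi)
        · exact (hxb i hi).symm.trans (hbz i hi)
    rw [Finset.sum_congr rfl heq, Finset.sum_const, nsmul_eq_mul]
    have hcard : ((E.filter fun x => r A x y ∧ r B x z).card : ℝ) ≤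
        agreeCount E w (A ∪ B) x₀ := by
      norm_cast
      refine Finset.card_le_card fun x => ?_
      simp only [Finset.mem_filter]
      rintro ⟨hx, hxa, hxb⟩
      refine ⟨hx, fun i hi => ?_⟩
      rcases Finset.mem_union.1 hi with hi | hi
      · exact (hxa i hi).symm.trans (hay i hi)
      · exact (hxb i hi).symm.trans (hbz i hi)
    calc _ ≤ (agreeCount E w (A ∪ B) x₀ : ℝ) *
          (1 / (agreeCount E w (A ∪ B) x₀ * agreeCount E w C y)) := by gcongr
      _ = _ := by field_simp
  have hind : ∀ S x, (agreeCount E w S x : ℝ) = ∑ y ∈ E, if r S x y then (1 : ℝ) else 0 := by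
    intro S x
    simp [agreeCount, r]
  calc _ = ∑ x ∈ E, ∑ y ∈ E, ∑ z ∈ E, if r A x y ∧ r B x z then
        (1 : ℝ) / (agreeCount E w (A ∪ B) x * agreeCount E w C x) else 0 := by
        refine Finset.sum_congr rfl fun x _ => ?_
        rw [hind A, hind B, Finset.sum_mul_sum, Finset.sum_div]
        refine Finset.sum_congr rfl fun y _ => ?_
        rw [Finset.sum_div]
        refine Finset.sum_congr rfl fun z _ => ?_
        by_cases h1 : r A x y <;> by_cases h2 : r B x z <;> simp [h1, h2]
    _ = ∑ y ∈ E, ∑ z ∈ E, ∑ x ∈ E with r A x y ∧ r B x z,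
        (1 : ℝ) / (agreeCount E w (A ∪ B) x * agreeCount E w C x) := by
        rw [Finset.sum_comm]
        refine Finset.sum_congr rfl fun y _ => ?_
        rw [Finset.sum_comm]
        refine Finset.sum_congr rfl fun z _ => ?_
        rw [Finset.sum_filter]
    _ ≤ ∑ y ∈ E, ∑ z ∈ E, if r C y z then (1 : ℝ) / agreeCount E w C y else 0 :=
        Finset.sum_le_sum fun y hy => Finset.sum_le_sum fun z hz => key y hy z hz
    _ = ∑ y ∈ E, 1 := by
        refine Finset.sum_congr rfl fun y hy => ?_
        have hposy : (0 : ℝ) < agreeCount E w C y := by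
          exact_mod_cast agreeCount_pos w _ hy
        rw [← Finset.sum_filter, Finset.sum_const, nsmul_eq_mul]
        change (agreeCount E w C y : ℝ) * _ = 1
        field_simp
    _ = _ := by simp

/-- Strong subadditivity of the Shannon entropy. -/
lemma nameEnt_submodular [DecidableEq ι] (E : Finset X) (w : X → ι → α) {A B C : Finset ι}
    (hA : C ⊆ A) (hB : C ⊆ B) :
    nameEnt E w (A ∪ B) + nameEnt E w C ≤ nameEnt E w A + nameEnt E w B := by
  have h := sum_agreeCount_ratio_le E w hA hB
  rw [nameEnt, nameEnt, nameEnt, nameEnt, ← sub_nonpos, ← Finset.sum_add_distrib,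
    ← Finset.sum_add_distrib, ← Finset.sum_sub_distrib]
  refine le_trans (Finset.sum_le_sum (g := fun x => (agreeCount E w A x * agreeCount E w B x : ℝ) /
      (agreeCount E w (A ∪ B) x * agreeCount E w C x) - 1) fun x hx => ?_) ?_
  · have pos : ∀ S, (0 : ℝ) < agreeCount E w S x := fun S => by
      exact_mod_cast agreeCount_pos w S hx
    have hA' := pos A
    have hB' := pos B
    have hC' := pos C
    have hU' := pos (A ∪ B)
    have := Real.log_le_sub_one_of_pos
      (show 0 < (agreeCount E w A x * agreeCount E w B x : ℝ) /
        (agreeCount E w (A ∪ B) x * agreeCount E w C x) by positivity)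
    rw [Real.log_div (by positivity) (by positivity), Real.log_mul hA'.ne' hB'.ne',
      Real.log_mul hU'.ne' hC'.ne'] at this
    linarith
  · rw [Finset.sum_sub_distrib]
    simpa using h

/-- Shearer's inequality. -/
lemma shearer [DecidableEq ι] (E : Finset X) (w : X → ι → α) {κ : Type*} (I : Finset κ)
    (S : κ → Finset ι) (k : ℕ) (F : Finset ι)
    (hcov : ∀ i ∈ F, k ≤ (I.filter fun j => i ∈ S j).card) :
    k * nameEnt E w F ≤ ∑ j ∈ I, nameEnt E w (S j ∩ F) := by
  induction F using Finset.induction_on with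
  | empty => simp [nameEnt_empty]
  | insert a F ha ih =>
    have ih' := ih fun i hi => hcov i (Finset.mem_insert_of_mem hi)
    set D := nameEnt E w (insert a F) - nameEnt E w F with hD
    have hD0 : 0 ≤ D := sub_nonneg.2 (nameEnt_mono E w (Finset.subset_insert a F))
    have h1 : ∑ j ∈ I, (if a ∈ S j then D else 0) ≤
        ∑ j ∈ I, (nameEnt E w (S j ∩ insert a F) - nameEnt E w (S j ∩ F)) := by
      refine Finset.sum_le_sum fun j _ => ?_
      split_ifs with haj
      · have := nameEnt_submodular E w (A := F) (B := S j ∩ insert a F) (C := S j ∩ F)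
          Finset.inter_subset_right
          (Finset.inter_subset_inter_left (Finset.subset_insert a F))
        have hU : F ∪ S j ∩ insert a F = insert a F := by
          ext i
          simp only [Finset.mem_union, Finset.mem_inter, Finset.mem_insert]
          constructor
          · tauto
          · rintro (rfl | h)
            · exact Or.inr ⟨haj, Or.inl rfl⟩
            · exact Or.inl h
        rw [hU] at this
        linarith
      · exact sub_nonneg.2 (nameEnt_mono E w
          (Finset.inter_subset_inter_left (Finset.subset_insert a F)))
    rw [← Finset.sum_filter, Finset.sum_const, nsmul_eq_mul, Finset.sum_sub_distrib] at h1
    have h2 : (k : ℝ) * D ≤ ((I.filter fun j => a ∈ S j).card : ℝ) * D := by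
      gcongr
      exact_mod_cast hcov a (Finset.mem_insert_self a F)
    rw [hD, mul_sub] at h2
    linarith

/-- Gibbs' inequality: the entropy of the names is at most the average code length of any code
satisfying Kraft's inequality. -/
lemma nameEnt_le_sum_code {β : Type*} [Fintype β] (E : Finset X) (w : X → ι → α) (S : Finset ι)
    (v : X → β) (hv : ∀ x y, (∀ i ∈ S, w y i = w x i) → v y = v x)
    (hv' : ∀ x y, v y = v x → ∀ i ∈ S, w y i = w x i)
    (c : β → ℝ) (hc : ∑ b, Real.exp (-c b) ≤ 1) :
    nameEnt E w S ≤ ∑ x ∈ E, c (v x) := by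
  classical
  have hN : ∀ x, agreeCount E w S x = (E.filter fun y => v y = v x).card := by
    intro x
    unfold agreeCount
    congr 1
    ext y
    simp only [Finset.mem_filter]
    exact and_congr_right fun _ => ⟨hv x y, hv' x y⟩
  rw [nameEnt, ← sub_nonpos, ← Finset.sum_sub_distrib]
  rcases E.eq_empty_or_nonempty with rfl | hE
  · simp
  have hE0 : (0 : ℝ) < E.card := by exact_mod_cast hE.card_pos
  have hsum : ∑ x ∈ E, Real.exp (-c (v x)) / agreeCount E w S x ≤ 1 := by
    refine le_trans ?_ hc
    rw [← Finset.sum_fiberwise E v]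
    refine Finset.sum_le_sum fun b _ => ?_
    have : ∀ x ∈ E.filter (fun x => v x = b), Real.exp (-c (v x)) / agreeCount E w S x =
        Real.exp (-c b) / (E.filter fun y => v y = b).card := by
      intro x hx
      rw [hN x, (Finset.mem_filter.1 hx).2]
    rw [Finset.sum_congr rfl this, Finset.sum_const, nsmul_eq_mul]
    rcases (E.filter fun y => v y = b).eq_empty_or_nonempty with h | h
    · rw [h]
      simpa using (Real.exp_pos _).le
    · have : (0 : ℝ) < (E.filter fun y => v y = b).card := by exact_mod_cast h.card_pos
      exact le_of_eq (by field_simp)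
  refine le_trans (Finset.sum_le_sum (g := fun x =>
    E.card * (Real.exp (-c (v x)) / agreeCount E w S x) - 1) fun x hx => ?_) ?_
  · have hp : (0 : ℝ) < agreeCount E w S x := by exact_mod_cast agreeCount_pos w S hx
    have := Real.log_le_sub_one_of_pos
      (show 0 < E.card * (Real.exp (-c (v x)) / agreeCount E w S x) by positivity)
    rw [Real.log_mul hE0.ne' (by positivity), Real.log_div (by positivity) hp.ne',
      Real.log_exp] at this
    linarith
  · rw [Finset.sum_sub_distrib, ← Finset.mul_sum]
    simp only [Finset.sum_const, nsmul_eq_mul, mul_one]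
    nlinarith

end Counting

/-- The translate averages of `nameEnt` bound the number of points with distinct names. -/
lemma card_mul_log_card_le [Group G] [DecidableEq G] (act : G → X → X)
    (hact_mul : ∀ g h x, act (g * h) x = act g (act h x)) {p : ℕ} (P : X → Fin p)
    (E : Finset X) (hE : E.Nonempty) (K F : Finset G)
    (c : (K → Fin p) → ℝ) (hc : ∑ b, Real.exp (-c b) ≤ 1) (B : ℝ)
    (hB : ∀ x ∈ E, ∑ g ∈ F, c (fun k => P (act k (act g x))) ≤ B)
    (hsep : ∀ x ∈ E, ∀ y ∈ E, (∀ g ∈ F, P (act g x) = P (act g y)) → x = y) :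
    K.card * Real.log E.card ≤ B + ((K⁻¹ * F) \ F).card * (K.card * Real.log p) := by
  classical
  have hE0 : (0 : ℝ) < E.card := by exact_mod_cast hE.card_pos
  have hp : 0 < p := (P hE.choose).pos
  let w : X → G → Fin p := fun x g => P (act g x)
  have hF : nameEnt E w F = E.card * Real.log E.card := by
    have : ∀ x ∈ E, agreeCount E w F x = 1 := by
      intro x hx
      refine Finset.card_eq_one.2 ⟨x, ?_⟩
      ext y
      simp only [Finset.mem_filter, Finset.mem_singleton]
      constructor
      · exact fun h => hsep y h.1 x hx h.2
      · rintro rfl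
        exact ⟨hx, fun _ _ => rfl⟩
    rw [nameEnt, Finset.sum_congr rfl fun x hx => by rw [this x hx]]
    simp
  have hgibbs : ∀ (g : G) (d : (K → Fin p) → ℝ), ∑ b, Real.exp (-d b) ≤ 1 →
      nameEnt E w (K.image (· * g) ∩ F) ≤ ∑ x ∈ E, d (fun k => P (act k (act g x))) := by
    intro g d hd
    refine (nameEnt_mono E w Finset.inter_subset_left).trans ?_
    refine nameEnt_le_sum_code E w _ (fun x (k : K) => P (act k (act g x))) ?_ ?_ d hd
    · intro x y h
      funext k
      have := h (k * g) (Finset.mem_image_of_mem _ k.2)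
      simpa only [w, hact_mul] using this
    · intro x y h i hi
      obtain ⟨k, hk, rfl⟩ := Finset.mem_image.1 hi
      have := congrFun h ⟨k, hk⟩
      simpa only [w, hact_mul] using this
  have hsh := shearer E w (K⁻¹ * F) (fun g => K.image (· * g)) K.card F (by
    intro i hi
    rw [← Finset.card_image_of_injective K (f := fun k => k⁻¹ * i) fun a b h => by simpa using h]
    refine Finset.card_le_card fun g hg => ?_
    obtain ⟨k, hk, rfl⟩ := Finset.mem_image.1 hg
    refine Finset.mem_filter.2 ⟨Finset.mul_mem_mul (Finset.inv_mem_inv hk) hi, ?_⟩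
    exact Finset.mem_image.2 ⟨k, hk, by simp⟩)
  have h1 : ∑ g ∈ (K⁻¹ * F) ∩ F, nameEnt E w (K.image (· * g) ∩ F) ≤ E.card * B := by
    refine (Finset.sum_le_sum_of_subset_of_nonneg (Finset.inter_subset_right) ?_).trans
      ((Finset.sum_le_sum fun g _ => hgibbs g c hc).trans ?_)
    · intro g _ _
      rw [← nameEnt_empty E w]
      exact nameEnt_mono E w (Finset.empty_subset _)
    · rw [Finset.sum_comm]
      refine (Finset.sum_le_sum hB).trans ?_
      simp
  have h2 : ∑ g ∈ (K⁻¹ * F) \ F, nameEnt E w (K.image (· * g) ∩ F) ≤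
      ((K⁻¹ * F) \ F).card * (E.card * (K.card * Real.log p)) := by
    rw [← nsmul_eq_mul, ← Finset.sum_const]
    refine Finset.sum_le_sum fun g _ => ?_
    refine (hgibbs g (fun _ => K.card * Real.log p) ?_).trans (by simp)
    have hpK : Real.exp (-(K.card * Real.log p)) = ((p : ℝ) ^ K.card)⁻¹ := by
      rw [Real.exp_neg, Real.exp_nat_mul, Real.exp_log (by positivity)]
    rw [hpK]
    simp only [Finset.sum_const, Finset.card_univ, Fintype.card_pi, Fintype.card_fin,
      Finset.prod_const, Fintype.card_coe, nsmul_eq_mul]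
    push_cast
    rw [mul_inv_cancel₀ (by positivity)]
  rw [hF] at hsh
  rw [← Finset.sum_inter_add_sum_sdiff (K⁻¹ * F) F] at hsh
  have : (E.card : ℝ) * (K.card * Real.log E.card) ≤
      E.card * (B + ((K⁻¹ * F) \ F).card * (K.card * Real.log p)) := by
    linarith
  exact le_of_mul_le_mul_left this hE0

/-- The thickened sets `K⁻¹ F_n` are asymptotically no larger than `F_n`. -/
lemma Folner.tendsto_inv_mul_sdiff [Group G] [DecidableEq G] {Fs : ℕ → Finset G}
    (hFol : Folner Fs) (K : Finset G) :
    Tendsto (fun n => (((K⁻¹ * Fs n) \ Fs n).card : ℝ) / (Fs n).card) atTop (𝓝 0) := by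
  have hlim : Tendsto (fun n => ∑ k ∈ K,
      (((((Fs n).image fun h => k⁻¹ * h) ∆ Fs n).card : ℝ) / ((Fs n).card : ℝ))) atTop (𝓝 0) := by
    simpa using tendsto_finsetSum K fun k _ => hFol.2 k⁻¹
  refine squeeze_zero (fun n => by positivity) (fun n => ?_) hlim
  rw [← Finset.sum_div]
  gcongr
  norm_cast
  refine (Finset.card_le_card ?_).trans Finset.card_biUnion_le
  intro g hg
  obtain ⟨hg, hgF⟩ := Finset.mem_sdiff.1 hg
  obtain ⟨k, hk, f, hf, rfl⟩ := Finset.mem_mul.1 hg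
  refine Finset.mem_biUnion.2 ⟨k⁻¹, Finset.mem_inv'.1 hk, ?_⟩
  rw [Finset.mem_symmDiff]
  exact Or.inl ⟨Finset.mem_image.2 ⟨f, hf, by simp⟩, hgF⟩

/-- A code satisfying Kraft's inequality whose average length is close to the entropy. -/
lemma exists_code {β : Type*} [Fintype β] (q : β → ℝ) (hq : ∀ b, 0 ≤ q b) (hsum : ∑ b, q b = 1)
    {δ : ℝ} (hδ : 0 < δ) :
    ∃ c : β → ℝ, (∀ b, 0 ≤ c b) ∧ ∑ b, Real.exp (-c b) ≤ 1 ∧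
      ∑ b, q b * c b ≤ ∑ b, Real.negMulLog (q b) + δ := by
  have hne : Nonempty β := by
    by_contra h
    rw [not_nonempty_iff] at h
    simp at hsum
  have hM : (0 : ℝ) < Fintype.card β := by exact_mod_cast Fintype.card_pos
  let Q : β → ℝ := fun b => (q b + δ / Fintype.card β) / (1 + δ)
  have hQ : ∀ b, 0 < Q b := fun b => by have := hq b; positivity
  have hQs : ∑ b, Q b = 1 := by
    simp only [Q]
    rw [← Finset.sum_div, Finset.sum_add_distrib, hsum]
    simp only [Finset.sum_const, Finset.card_univ, nsmul_eq_mul]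
    field_simp
  refine ⟨fun b => -Real.log (Q b), fun b => ?_, ?_, ?_⟩
  · have : Q b ≤ 1 := hQs ▸ Finset.single_le_sum (fun b _ => (hQ b).le) (Finset.mem_univ b)
    exact neg_nonneg.2 (Real.log_nonpos (hQ b).le this)
  · simp only [neg_neg]
    rw [Finset.sum_congr rfl fun b _ => Real.exp_log (hQ b), hQs]
  · have : ∑ b, Real.negMulLog (q b) + δ = ∑ b, (Real.negMulLog (q b) + q b * δ) := by
      rw [Finset.sum_add_distrib, ← Finset.sum_mul, hsum, one_mul]
    rw [this]
    refine Finset.sum_le_sum fun b _ => ?_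
    rcases (hq b).eq_or_lt with h | h
    · simp [← h]
    · have h1 : q b / (1 + δ) ≤ Q b := by
        simp only [Q]
        gcongr
        have : 0 ≤ δ / Fintype.card β := by positivity
        linarith
      have h2 := Real.log_le_log (by positivity) h1
      rw [Real.log_div h.ne' (by positivity)] at h2
      have h3 := Real.log_le_sub_one_of_pos (show 0 < 1 + δ by positivity)
      rw [Real.negMulLog]
      nlinarith

/-- An indicator of a set whose closure has no extra mass is approximated from above by continuous
functions. -/
lemma exists_continuous_ge_indicator [PseudoMetricSpace X] [MeasurableSpace X] [BorelSpace X]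
    (μ : Measure X) [IsFiniteMeasure μ] (A : Set X) (hA : μ (closure A) = μ A) {δ : ℝ}
    (hδ : 0 < δ) :
    ∃ f : C(X, ℝ), (∀ x, 0 ≤ f x) ∧ (∀ x ∈ A, 1 ≤ f x) ∧ Integrable f μ ∧
      ∫ x, f x ∂μ ≤ (μ A).toReal + δ := by
  have h := tendsto_integral_thickenedIndicator_of_isClosed μ (isClosed_closure (s := A))
    (δs := fun n : ℕ => 1 / ((n : ℝ) + 1)) (fun n => by positivity)
    tendsto_one_div_add_atTop_nhds_zero_nat
  rw [measureReal_def, hA] at h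
  obtain ⟨n, hn⟩ := (h.eventually (gt_mem_nhds (lt_add_of_pos_right _ hδ))).exists
  have hpos : (0 : ℝ) < 1 / ((n : ℝ) + 1) := by positivity
  refine ⟨⟨fun x => (thickenedIndicator hpos (closure A) x : ℝ), by fun_prop⟩, fun x => ?_,
    fun x hx => ?_, ?_, hn.le⟩
  · exact NNReal.coe_nonneg _
  · have := thickenedIndicator_one hpos (closure A) (subset_closure hx)
    change (1 : ℝ) ≤ (thickenedIndicator hpos (closure A) x : ℝ)
    rw [this, NNReal.coe_one]
  · exact integrable_thickenedIndicator _ hpos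

/-- A nonnegative simple function which is locally constant almost everywhere is approximated from
above by continuous functions. -/
lemma exists_continuous_ge_simple [PseudoMetricSpace X] [MeasurableSpace X] [BorelSpace X]
    (μ : Measure X) [IsFiniteMeasure μ] {β : Type*} [Fintype β] (v : X → β)
    (hv : ∀ᵐ y ∂μ, ∀ᶠ z in 𝓝 y, v z = v y) (c : β → ℝ) (hc : ∀ b, 0 ≤ c b) {δ : ℝ}
    (hδ : 0 < δ) :
    ∃ ψ : C(X, ℝ), (∀ x, c (v x) ≤ ψ x) ∧
      ∫ x, ψ x ∂μ ≤ ∑ b, (μ (v ⁻¹' {b})).toReal * c b + δ := by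
  have hcl : ∀ b, μ (closure (v ⁻¹' {b})) = μ (v ⁻¹' {b}) := by
    intro b
    refine le_antisymm (measure_mono_ae ?_) (measure_mono subset_closure)
    filter_upwards [hv] with y hy hyb
    obtain ⟨z, hz, hzb⟩ := ((mem_closure_iff_frequently.1 hyb).and_eventually hy).exists
    exact hzb.symm.trans hz
  have hC : 0 ≤ ∑ b, c b := Finset.sum_nonneg fun b _ => hc b
  choose f hf0 hf1 hfi hf using fun b => exists_continuous_ge_indicator μ (v ⁻¹' {b}) (hcl b)
    (show 0 < δ / (1 + ∑ b, c b) by positivity)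
  refine ⟨∑ b, c b • f b, fun x => ?_, ?_⟩
  · simp only [ContinuousMap.coe_sum, ContinuousMap.coe_smul, Finset.sum_apply, Pi.smul_apply,
      smul_eq_mul]
    refine le_trans ?_ (Finset.single_le_sum (fun b _ => mul_nonneg (hc b) (hf0 b x))
      (Finset.mem_univ (v x)))
    exact le_mul_of_one_le_right (hc _) (hf1 (v x) x rfl)
  · simp only [ContinuousMap.coe_sum, ContinuousMap.coe_smul, Finset.sum_apply, Pi.smul_apply,
      smul_eq_mul]
    rw [integral_finsetSum _ fun b _ => (hfi b).const_mul _]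
    simp only [integral_const_mul]
    calc _ ≤ ∑ b, c b * ((μ (v ⁻¹' {b})).toReal + δ / (1 + ∑ b, c b)) :=
          Finset.sum_le_sum fun b _ => mul_le_mul_of_nonneg_left (hf b) (hc b)
      _ = ∑ b, (μ (v ⁻¹' {b})).toReal * c b + (∑ b, c b) * (δ / (1 + ∑ b, c b)) := by
          simp only [mul_add, Finset.sum_add_distrib, Finset.sum_mul, mul_comm]
      _ ≤ _ := by
          gcongr
          rw [mul_div_assoc', div_le_iff₀ (by positivity)]
          nlinarith

/-- A finite measurable partition of small mesh which is locally constant almost everywhere. -/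
lemma exists_partition [MetricSpace X] [CompactSpace X] [MeasurableSpace X] [BorelSpace X]
    (μ : Measure X) [IsFiniteMeasure μ] {ε : ℝ} (hε : 0 < ε) :
    ∃ (p : ℕ) (P : X → Fin p), Measurable P ∧ (∀ x y, P x = P y → dist x y ≤ ε) ∧
      ∀ᵐ y ∂μ, ∀ᶠ z in 𝓝 y, P z = P y := by
  classical
  have h : ∀ x : X, ∃ r ∈ Ioo 0 (ε / 2), μ (frontier (Metric.ball x r)) = 0 := by
    intro x
    simpa only [Metric.thickening_singleton] using
      exists_null_frontier_thickening μ {x} (show (0 : ℝ) < ε / 2 by positivity)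
  choose r hr hr0 using h
  obtain ⟨t, ht⟩ := isCompact_univ.elim_finite_subcover (fun x => Metric.ball x (r x))
    (fun x => Metric.isOpen_ball)
    (fun x _ => mem_iUnion.2 ⟨x, Metric.mem_ball_self (hr x).1⟩)
  let v : X → t → Bool := fun y x => decide (y ∈ Metric.ball (x : X) (r x))
  let e := Fintype.equivFin (t → Bool)
  refine ⟨_, fun y => e (v y), ?_, fun x y hxy => ?_, ?_⟩
  · refine (measurable_of_countable e).comp (measurable_pi_iff.2 fun x => ?_)
    refine measurable_to_bool ?_
    convert (Metric.isOpen_ball (x := (x : X)) (ε := r x)).measurableSet using 1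
    ext y
    simp [v]
  · have hv : v x = v y := e.injective hxy
    obtain ⟨z, hzt, hz⟩ := mem_iUnion₂.1 (ht (mem_univ x))
    have hy : y ∈ Metric.ball z (r z) := by
      have := congrFun hv ⟨z, hzt⟩
      simp only [v, decide_eq_decide] at this
      exact this.1 hz
    have h1 := dist_triangle_right x y z
    rw [Metric.mem_ball] at hz hy
    have := (hr z).2
    linarith
  · have : ∀ᵐ y ∂μ, ∀ x : t, y ∉ frontier (Metric.ball (x : X) (r x)) := by
      rw [ae_all_iff]
      exact fun x => measure_eq_zero_iff_ae_notMem.1 (hr0 x)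
    filter_upwards [this] with y hy
    have h2 : ∀ᶠ z in 𝓝 y, ∀ x : t, v z x = v y x := by
      rw [eventually_all]
      intro x
      by_cases hyx : y ∈ Metric.ball (x : X) (r x)
      · filter_upwards [Metric.isOpen_ball.mem_nhds hyx] with z hz
        simp only [v, decide_eq_decide]
        exact iff_of_true hz hyx
      · have hyc : y ∉ closure (Metric.ball (x : X) (r x)) := fun hcl =>
          hy x ⟨hcl, fun hi => hyx (interior_subset hi)⟩
        filter_upwards [isClosed_closure.isOpen_compl.mem_nhds hyc] with z hz
        simp only [v, decide_eq_decide]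
        exact iff_of_false (fun h => hz (subset_closure h)) hyx
    filter_upwards [h2] with z hz
    rw [funext hz]

/-- The packing pre-measure is bounded by a series of separated-set cardinalities. -/
lemma packP_le_tsum [PseudoMetricSpace X] (act : G → X → X) (Fs : ℕ → Finset G) (Z : Set X)
    (N : ℕ) {ε : ℝ} (hε : 0 ≤ ε) (s a : ℝ)
    (hcard : ∀ n, N ≤ n → ∀ E : Finset X, ↑E ⊆ Z → IsDynSeparated act (Fs n) ε ↑E →
      (E.card : ℝ) ≤ Real.exp (a * (Fs n).card)) :
    packP act Fs Z N ε s ≤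
      ∑' n, ENNReal.ofReal (Real.exp (-(s - a) * ((Fs (n + N)).card : ℝ))) := by
  classical
  refine iSup_le fun t => iSup_le fun c => iSup_le fun hc => iSup_le fun hdisj => ?_
  rw [ENNReal.tsum_eq_iSup_sum]
  refine iSup_le fun T => ?_
  rw [← Finset.sum_fiberwise_of_maps_to (s := T) (t := T.image fun i : t => (c i).2)
    (g := fun i : t => (c i).2)
    fun i hi => Finset.mem_image_of_mem _ hi]
  have hself : ∀ i, (c i).1 ∈ dynClosedBall act (Fs (c i).2) (c i).1 ε := fun i g _ => by
    rw [dist_self]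
    exact hε
  have key : ∀ n ∈ T.image fun i : t => (c i).2,
      ∑ i ∈ T.filter (fun i : t => (c i).2 = n), ENNReal.ofReal (Real.exp (-s * ((Fs (c i).2).card : ℝ))) ≤
        ENNReal.ofReal (Real.exp (-(s - a) * ((Fs n).card : ℝ))) := by
    intro n hn
    have hNn : N ≤ n := by
      obtain ⟨i, _, rfl⟩ := Finset.mem_image.1 hn
      exact (hc i i.2).2
    have hinj : Set.InjOn (fun i : t => (c i).1) (T.filter fun i : t => (c i).2 = n) := by
      intro i _ j _ hij
      by_contra hne
      have hij' : (c i).1 = (c j).1 := hij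
      refine Set.disjoint_left.1 (hdisj i i.2 j j.2 fun h => hne (Subtype.ext h)) (hself i) ?_
      rw [hij']
      exact hself j
    have h1 := hcard n hNn ((T.filter fun i : t => (c i).2 = n).image fun i : t => (c i).1) (by
        intro x hx
        simp only [Finset.coe_image, mem_image] at hx
        obtain ⟨i, _, rfl⟩ := hx
        exact (hc i i.2).1) (by
        intro x hx y hy hxy
        simp only [Finset.coe_image, mem_image, Finset.coe_filter, mem_ofPred_eq] at hx hy
        obtain ⟨i, ⟨_, hi⟩, rfl⟩ := hx
        obtain ⟨j, ⟨_, hj⟩, rfl⟩ := hy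
        by_contra! hcon
        refine Set.disjoint_left.1 (hdisj i i.2 j j.2 fun h => hxy (by rw [h])) ?_ (hself j)
        rw [hi]
        exact hcon)
    rw [Finset.card_image_of_injOn hinj] at h1
    rw [Finset.sum_congr rfl (g := fun _ => ENNReal.ofReal (Real.exp (-s * ((Fs n).card : ℝ))))
      fun i hi => by rw [(Finset.mem_filter.1 hi).2], Finset.sum_const, nsmul_eq_mul,
      ← ENNReal.ofReal_natCast, ← ENNReal.ofReal_mul (by positivity)]
    refine ENNReal.ofReal_le_ofReal ?_
    calc _ ≤ Real.exp (a * (Fs n).card) * Real.exp (-s * (Fs n).card) := by gcongr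
      _ = _ := by rw [← Real.exp_add]; ring_nf
  refine (Finset.sum_le_sum key).trans ?_
  have hshift : ∀ n ∈ T.image fun i : t => (c i).2, n - N + N = n := by
    intro n hn
    obtain ⟨i, _, rfl⟩ := Finset.mem_image.1 hn
    exact Nat.sub_add_cancel (hc i i.2).2
  rw [Finset.sum_congr rfl (g := fun n =>
    ENNReal.ofReal (Real.exp (-(s - a) * ((Fs (n - N + N)).card : ℝ)))) fun n hn => by
      rw [hshift n hn]]
  rw [← Finset.sum_image (s := T.image fun i : t => (c i).2) (g := fun n => n - N)
    (f := fun n => ENNReal.ofReal (Real.exp (-(s - a) * ((Fs (n + N)).card : ℝ))))]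
  · exact ENNReal.sum_le_tsum _
  · intro m hm n hn hmn
    rw [← hshift m hm, ← hshift n hn]
    exact congrArg (· + N) hmn

/-- The growth condition makes the series of `exp (-d |F_n|)` converge. -/
lemma GrowthCond.tsum_exp_ne_top [Group G] {Fs : ℕ → Finset G} (hgrow : GrowthCond Fs) {d : ℝ}
    (hd : 0 < d) : ∑' n, ENNReal.ofReal (Real.exp (-d * ((Fs n).card : ℝ))) ≠ ∞ := by
  have hsum : Summable fun n => Real.exp (-d * ((Fs n).card : ℝ)) := by
    refine (Real.summable_nat_pow_inv.2 one_lt_two).of_norm_bounded_eventually_nat ?_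
    filter_upwards [hgrow.eventually_ge_atTop (2 / d), eventually_ge_atTop 2] with n hn hn2
    have hn0 : (0 : ℝ) < n := by positivity
    have hlog : 0 < Real.log n := Real.log_pos (by exact_mod_cast hn2)
    rw [Real.norm_of_nonneg (Real.exp_pos _).le, ← Real.exp_log (show (0 : ℝ) < ((n : ℝ) ^ 2)⁻¹ by
      positivity), Real.exp_le_exp, Real.log_inv, Real.log_pow]
    rw [div_le_div_iff₀ hd hlog] at hn
    push_cast
    linarith
  exact hsum.tsum_ofReal_ne_top

/-- The packing entropy at scale `ε` is controlled by the growth of separated sets on the pieces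
of a countable cover. -/
lemma packOuter_eq_zero [Group G] [PseudoMetricSpace X] (act : G → X → X) {Fs : ℕ → Finset G}
    (hgrow : GrowthCond Fs) (Z : Set X) {ε : ℝ} (hε : 0 ≤ ε) {s a : ℝ} (has : a < s)
    (Zs : ℕ → Set X) (hZ : Z ⊆ ⋃ i, Zs i)
    (hcard : ∀ i, ∀ᶠ n in atTop, ∀ E : Finset X, ↑E ⊆ Zs i → IsDynSeparated act (Fs n) ε ↑E →
      (E.card : ℝ) ≤ Real.exp (a * (Fs n).card)) :
    packOuter act Fs Z ε s = 0 := by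
  have hlim := ENNReal.tendsto_sum_nat_add _ (hgrow.tsum_exp_ne_top (sub_pos.2 has))
  refine le_antisymm (iInf₂_le_of_le Zs hZ ?_) bot_le
  rw [nonpos_iff_eq_zero, ENNReal.tsum_eq_zero]
  intro i
  obtain ⟨N₀, hN₀⟩ := eventually_atTop.1 (hcard i)
  refine le_antisymm (ge_of_tendsto hlim ?_) bot_le
  filter_upwards [eventually_ge_atTop N₀] with N hN
  exact iInf_le_of_le N (packP_le_tsum act Fs (Zs i) N hε s a fun n hn => hN₀ n (hN.trans hn))

/-- The main estimate: if a finite window `K` and a fine partition `P` have entropy less than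
`h |K|`, then the packing sum of the generic points vanishes at every exponent above `h`. -/
lemma packOuter_genericPoints_eq_zero [Group G] [DecidableEq G]
    [MetricSpace X] [CompactSpace X] [MeasurableSpace X] [BorelSpace X]
    (act : G → X → X) (hact_mul : ∀ g h x, act (g * h) x = act g (act h x))
    (hact_cont : ∀ g : G, Continuous (act g))
    {Fs : ℕ → Finset G} (hFol : Folner Fs) (hgrow : GrowthCond Fs)
    (μ : Measure X) [IsProbabilityMeasure μ] (hinv : InvariantMeasure act μ)
    {ε : ℝ} (hε : 0 ≤ ε) {p : ℕ} (P : X → Fin p) (hPm : Measurable P)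
    (hPε : ∀ x y, P x = P y → dist x y ≤ ε) (hP : ∀ᵐ y ∂μ, ∀ᶠ z in 𝓝 y, P z = P y)
    (K : Finset G) (hK : K.Nonempty) {h s : ℝ} (hs : h < s)
    (hent : partEnt μ (fun x (g : K) => P (act (g : G) x)) ≤ h * K.card) :
    packOuter act Fs (genericPoints act Fs μ) ε s = 0 := by
  classical
  have hK1 : (1 : ℝ) ≤ K.card := by exact_mod_cast hK.card_pos
  set v : X → K → Fin p := fun x g => P (act (g : G) x) with hv
  have hvm : Measurable v := measurable_pi_iff.2 fun g => hPm.comp (hact_cont g).measurable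
  have hvae : ∀ᵐ y ∂μ, ∀ᶠ z in 𝓝 y, v z = v y := by
    have : ∀ g : K, ∀ᵐ y ∂μ, ∀ᶠ z in 𝓝 y, P (act (g : G) z) = P (act (g : G) y) := by
      intro g
      have hmp : MeasurePreserving (act (g : G)) μ μ :=
        ⟨(hact_cont g).measurable, Measure.ext fun A hA => by
          rw [Measure.map_apply (hact_cont g).measurable hA, hinv g A hA]⟩
      filter_upwards [hmp.quasiMeasurePreserving.ae hP] with y hy
      exact (hact_cont g).continuousAt.eventually hy
    filter_upwards [ae_all_iff.2 this] with y hy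
    filter_upwards [eventually_all.2 hy] with z hz using funext hz
  set δ := (s - h) / 12 with hδ
  have hδ0 : 0 < δ := by rw [hδ]; linarith
  obtain ⟨c, hc0, hc1, hc2⟩ := exists_code (fun b => (μ (v ⁻¹' {b})).toReal)
    (fun b => ENNReal.toReal_nonneg) (by
      have := sum_measureReal_preimage_singleton (μ := μ) (f := v) Finset.univ
        fun b _ => hvm (measurableSet_singleton b)
      simpa [measureReal_def] using this) hδ0
  obtain ⟨ψ, hψc, hψ⟩ := exists_continuous_ge_simple μ v hvae c hc0 hδ0
  rw [partEnt] at hent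
  have hψ' : ∫ x, ψ x ∂μ + δ ≤ h * K.card + 3 * δ := by linarith
  refine packOuter_eq_zero act hgrow _ hε (a := h + 6 * δ) (by rw [hδ]; linarith)
    (fun i => {x | ∀ n, i ≤ n → (∑ g ∈ Fs n, ψ (act g x)) / ((Fs n).card : ℝ) ≤
      ∫ x, ψ x ∂μ + δ}) ?_ ?_
  · intro x hx
    obtain ⟨i, hi⟩ := eventually_atTop.1
      ((hx ψ).eventually (ge_mem_nhds (lt_add_of_pos_right _ hδ0)))
    exact mem_iUnion.2 ⟨i, hi⟩
  · intro i
    have hlim := (hFol.tendsto_inv_mul_sdiff K).mul_const (Real.log p)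
    rw [zero_mul] at hlim
    filter_upwards [eventually_ge_atTop i, hlim.eventually (ge_mem_nhds hδ0)] with n hn hsmall E
      hEZ hEsep
    rcases E.eq_empty_or_nonempty with rfl | hE
    · simpa using (Real.exp_pos _).le
    have hF0 : (0 : ℝ) < (Fs n).card := by exact_mod_cast (hFol.1 n).card_pos
    have hcount := card_mul_log_card_le act hact_mul P E hE K (Fs n) c hc1
      ((Fs n).card * (∫ x, ψ x ∂μ + δ)) (fun x hx => ?_) (fun x hx y hy hxy => ?_)
    · have hE0 : (0 : ℝ) < E.card := by exact_mod_cast hE.card_pos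
      rw [← Real.log_le_iff_le_exp hE0]
      have h1 : (((K⁻¹ * Fs n) \ Fs n).card : ℝ) * Real.log p ≤ δ * (Fs n).card := by
        rw [← div_le_iff₀ hF0, ← div_mul_eq_mul_div]
        exact hsmall
      refine le_of_mul_le_mul_left ?_ (show (0 : ℝ) < K.card by linarith)
      calc _ ≤ (Fs n).card * (∫ x, ψ x ∂μ + δ) +
            ((K⁻¹ * Fs n) \ Fs n).card * (K.card * Real.log p) := hcount
        _ ≤ (Fs n).card * (h * K.card + 3 * δ) + K.card * (δ * (Fs n).card) := by
            refine add_le_add (mul_le_mul_of_nonneg_left hψ' hF0.le) ?_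
            rw [mul_left_comm]
            exact mul_le_mul_of_nonneg_left h1 (by linarith)
        _ ≤ _ := by
            have : (Fs n).card * δ ≤ K.card * ((Fs n).card * δ) :=
              le_mul_of_one_le_left (by positivity) hK1
            nlinarith
    · have h1 := hEZ hx n hn
      rw [div_le_iff₀' hF0] at h1
      exact (Finset.sum_le_sum fun g _ => hψc (act g x)).trans h1
    · by_contra hne
      obtain ⟨g, hg, hlt⟩ := hEsep x hx y hy hne
      exact absurd (hPε _ _ (hxy g hg)) (not_le.2 hlt)

theorem packing_entropy_generic_points_upper_bound
    [Group G] [Countable G] [Infinite G] [DecidableEq G]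
    [MetricSpace X] [CompactSpace X] [MeasurableSpace X] [BorelSpace X]
    (act : G → X → X)
    (hact_one : ∀ x, act 1 x = x)
    (hact_mul : ∀ g h x, act (g * h) x = act g (act h x))
    (hact_cont : ∀ g : G, Continuous (act g))
    (Fs : ℕ → Finset G) (hFol : Folner Fs) (hgrow : GrowthCond Fs)
    (μ : Measure X) [IsProbabilityMeasure μ] (hinv : InvariantMeasure act μ) :
    packEnt act Fs (genericPoints act Fs μ) ≤ measEnt act Fs μ := by
  refine iSup₂_le fun ε hε => le_of_forall_gt_imp_ge_of_dense fun s hs => ?_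
  obtain ⟨s', hs', hs's⟩ := ENNReal.lt_iff_exists_nnreal_btwn.1 hs
  obtain ⟨h, hh, hhs⟩ := ENNReal.lt_iff_exists_nnreal_btwn.1 hs'
  refine le_trans (iInf₂_le s' ?_) hs's.le
  obtain ⟨p, P, hPm, hPε, hP⟩ := exists_partition μ hε
  have hlimsup := lt_of_le_of_lt (le_iSup₂_of_le (f := fun (k : ℕ) (P : X → Fin k) =>
    ⨆ (_ : Measurable P), limsup (fun n => ENNReal.ofReal
      ((partEnt μ fun x (g : (Fs n : Finset G)) => P (act (g : G) x)) / ((Fs n).card : ℝ)))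
      atTop) p P (le_iSup_of_le hPm le_rfl)) hh
  obtain ⟨m, hm⟩ := (eventually_lt_of_limsup_lt hlimsup).exists
  have hF0 : (0 : ℝ) < (Fs m).card := by exact_mod_cast (hFol.1 m).card_pos
  refine packOuter_genericPoints_eq_zero act hact_mul hact_cont hFol hgrow μ hinv hε.le P hPm hPε
    hP (Fs m) (hFol.1 m) (h := h) (by exact_mod_cast hhs) ?_
  rw [← div_le_iff₀ hF0]
  rw [← ENNReal.ofReal_coe_nnreal] at hm
  exact (ENNReal.ofReal_lt_ofReal_iff'.1 hm).1.le

end AmenablePacking
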